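/- arXiv:2403.05733 — 4 statements merged into one kernel-verified Lean document; each statement's English description precedes it below -/
import Mathlib

section
/- Let x_1, …, x_M be points in ℝ^d, let w_1, …, w_M > 0, and let n ∈ ℕ. Let N be the dimension of the real vector space of restrictions to the set {x_1, …, x_M} of d-variate real polynomials of total degree at most n. Then there exist nonnegative reals u_1, …, u_M, of which at most N are strictly positive, such that Σ_{i=1}^M u_i q(x_i) = Σ_{i=1}^M w_i q(x_i) for every d-variate real polynomial q of total degree at most n. -/
/-- **Carathéodory's theorem for conical combinations**: a conical combination of a finite family
of vectors is a conical combination of at most `finrank` many of them. -/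
theorem exists_nonneg_sum_smul_eq_of_card_pos_le_finrank {𝕜 E ι : Type*} [Field 𝕜] [LinearOrder 𝕜]
    [IsStrictOrderedRing 𝕜] [AddCommGroup E] [Module 𝕜 E] [FiniteDimensional 𝕜 E] [Fintype ι]
    (v : ι → E) (w : ι → 𝕜) (hw : ∀ i, 0 ≤ w i) :
    ∃ u : ι → 𝕜, (∀ i, 0 ≤ u i) ∧
      (Finset.univ.filter fun i => 0 < u i).card ≤ Module.finrank 𝕜 E ∧
      ∑ i, u i • v i = ∑ i, w i • v i := by
  induction hk : (Finset.univ.filter fun i => 0 < w i).card using Nat.strong_induction_on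
    generalizing w with
  | _ k ih =>
  set s := Finset.univ.filter fun i => 0 < w i
  by_cases hcard : s.card ≤ Module.finrank 𝕜 E
  · exact ⟨w, hw, hcard, rfl⟩
  have hdep : ¬ LinearIndepOn 𝕜 v (s : Set ι) := fun h =>
    hcard (by simpa using LinearIndependent.fintype_card_le_finrank h)
  obtain ⟨c, hc, i₁, hi₁, hpos⟩ : ∃ c : ι → 𝕜, ∑ i ∈ s, c i • v i = 0 ∧ ∃ i ∈ s, 0 < c i := by
    rw [linearIndepOn_finset_iff] at hdep
    push Not at hdep
    obtain ⟨c, hc, i, hi, hne⟩ := hdep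
    rcases lt_or_gt_of_ne hne with h | h
    · exact ⟨-c, by simp [hc], i, hi, by simpa using h⟩
    · exact ⟨c, hc, i, hi, h⟩
  obtain ⟨j, hj, hmin⟩ := (s.filter fun i => 0 < c i).exists_min_image (fun i => w i / c i)
    ⟨i₁, Finset.mem_filter.2 ⟨hi₁, hpos⟩⟩
  obtain ⟨hjs, hcj⟩ := Finset.mem_filter.1 hj
  have hwj : 0 < w j := (Finset.mem_filter.1 hjs).2
  set r := w j / c j with hr
  have hr0 : 0 < r := div_pos hwj hcj
  classical
  set u : ι → 𝕜 := fun i => w i - r * (if i ∈ s then c i else 0) with hu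
  have hu_off : ∀ i, i ∉ s → u i = w i := fun i hi => by simp [hu, hi]
  have hu_j : u j = 0 := by simp [hu, hjs, hr, hcj.ne']
  have hu0 : ∀ i, 0 ≤ u i := by
    intro i
    by_cases hi : i ∈ s
    · simp only [hu, hi, if_true, sub_nonneg]
      rcases le_or_gt (c i) 0 with h | h
      · exact (mul_nonpos_of_nonneg_of_nonpos hr0.le h).trans (hw i)
      · exact (le_div_iff₀ h).1 (hmin i (Finset.mem_filter.2 ⟨hi, h⟩))
    · rw [hu_off i hi]
      exact hw i
  have hlt : (Finset.univ.filter fun i => 0 < u i).card < k := by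
    rw [← hk]
    refine Finset.card_lt_card ⟨fun i hi => ?_, fun h => ?_⟩
    · by_contra his
      rw [Finset.mem_filter, hu_off i his] at hi
      exact his (Finset.mem_filter.2 hi)
    · exact (Finset.mem_filter.1 (h hjs)).2.ne' hu_j
  obtain ⟨u', hu'0, hu'card, hu'sum⟩ := ih _ hlt u hu0 rfl
  refine ⟨u', hu'0, hu'card, hu'sum.trans ?_⟩
  simp [hu, sub_smul, mul_smul, ite_smul, ← Finset.smul_sum, hc]

/-- **discrete Tchakaloff theorem.** Given points `x_1,…,x_M ∈ ℝ^d`, positive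
weights `w_1,…,w_M`, and `n ∈ ℕ`, let `N` be the dimension of the space of restrictions to
`{x_1,…,x_M}` of `d`-variate polynomials of total degree at most `n`. Then there exist
nonnegative weights `u_1,…,u_M`, at most `N` of which are strictly positive, matching all the
moments of `w` up to degree `n`. -/
theorem discrete_tchakaloff
    (d n M : ℕ) (x : Fin M → (Fin d → ℝ)) (w : Fin M → ℝ) (hw : ∀ i, 0 < w i)
    (N : ℕ)
    (hN : N = Module.finrank ℝ (Submodule.span ℝ
      {g : ↥(Set.range x) → ℝ | ∃ q : MvPolynomial (Fin d) ℝ, q.totalDegree ≤ n ∧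
        ∀ t : ↥(Set.range x), g t = MvPolynomial.eval (t : Fin d → ℝ) q})) :
    ∃ u : Fin M → ℝ, (∀ i, 0 ≤ u i) ∧
      (Finset.univ.filter fun i => 0 < u i).card ≤ N ∧
      ∀ q : MvPolynomial (Fin d) ℝ, q.totalDegree ≤ n →
        ∑ i, u i * MvPolynomial.eval (x i) q = ∑ i, w i * MvPolynomial.eval (x i) q := by
  set V := Submodule.span ℝ
      {g : ↥(Set.range x) → ℝ | ∃ q : MvPolynomial (Fin d) ℝ, q.totalDegree ≤ n ∧
        ∀ t : ↥(Set.range x), g t = MvPolynomial.eval (t : Fin d → ℝ) q}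
  obtain ⟨u, hu0, hcard, hsum⟩ := exists_nonneg_sum_smul_eq_of_card_pos_le_finrank
    (fun i => (LinearMap.proj (⟨x i, i, rfl⟩ : Set.range x) ∘ₗ V.subtype : Module.Dual ℝ V))
    w fun i => (hw i).le
  refine ⟨u, hu0, by rwa [hN, ← Subspace.dual_finrank_eq], fun q hq => ?_⟩
  simpa using LinearMap.congr_fun hsum
    ⟨fun t => MvPolynomial.eval (t : Fin d → ℝ) q, Submodule.subset_span ⟨q, hq, fun _ => rfl⟩⟩
end

section
/- For every n ∈ ℕ, the real vector space of functions on the unit sphere S² = {(x,y,z) ∈ ℝ³ : x²+y²+z² = 1} obtained by restricting to S² the real polynomials in three variables of total degree at most n has dimension (n+1)². -/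
open MvPolynomial

/-- The function `(x, y, z) ↦ p(x, y) + z q(x, y)` on a set of points of `ℝ³`, for `p` and `q`
supported in degrees below `k` and `l`. -/
noncomputable def evalAddMulThird (S : Set (Fin 3 → ℝ)) (k l : ℕ) :
    (restrictSupport ℝ {d : Fin 2 →₀ ℕ | d.degree < k} ×
      restrictSupport ℝ {d : Fin 2 →₀ ℕ | d.degree < l}) →ₗ[ℝ] (S → ℝ) where
  toFun pq t := eval (fun i : Fin 2 => t.1 i.castSucc) pq.1.1 +
    t.1 2 * eval (fun i : Fin 2 => t.1 i.castSucc) pq.2.1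
  map_add' p q := by ext t; simp; ring
  map_smul' c p := by ext t; simp [smul_eval]; ring

theorem mem_restrictSupport_degree_lt_of_totalDegree_lt {σ R : Type*} [CommSemiring R] {k : ℕ}
    {p : MvPolynomial σ R} (h : p.totalDegree < k) :
    p ∈ restrictSupport R {d : σ →₀ ℕ | d.degree < k} :=
  fun _ hd => (le_totalDegree hd).trans_lt h

theorem totalDegree_lt_of_mem_restrictSupport {σ R : Type*} [CommSemiring R] {k : ℕ}
    (hk : 0 < k) {p : MvPolynomial σ R}
    (h : p ∈ restrictSupport R {d : σ →₀ ℕ | d.degree < k}) : p.totalDegree < k :=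
  (Finset.sup_lt_iff (by simpa using hk)).2 fun _ hd => h hd

theorem ncard_degree_lt (k : ℕ) :
    {d : Fin 2 →₀ ℕ | d.degree < k}.ncard = ∑ i ∈ Finset.range k, (i + 1) := by
  have h : {d : Fin 2 →₀ ℕ | d.degree < k} =
      ((Finset.range k).biUnion fun i => Finset.finsuppAntidiag Finset.univ i :
        Finset (Fin 2 →₀ ℕ)) := by
    ext d
    simp [Finsupp.degree_eq_sum]
  rw [h, Set.ncard_coe_finset, Finset.card_biUnion]
  · refine Finset.sum_congr rfl fun i _ => ?_
    simp [Finset.card_finsuppAntidiag_nat_eq_choose, add_comm]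
  · intro i _ j _ hij
    refine Finset.disjoint_left.2 fun d hd hd' => ?_
    simp only [Finset.mem_finsuppAntidiag] at hd hd'
    exact hij (hd.1.symm.trans hd'.1)

theorem finite_degree_lt {σ : Type*} [Finite σ] (k : ℕ) :
    {d : σ →₀ ℕ | d.degree < k}.Finite :=
  (Finsupp.finite_of_degree_le k).subset fun _ hd => (show _ < k from hd).le

theorem finrank_restrictSupport {σ R : Type*} [CommRing R] [StrongRankCondition R]
    (s : Set (σ →₀ ℕ)) : Module.finrank R (restrictSupport R s) = s.ncard := by
  rw [Module.finrank_eq_nat_card_basis (basisRestrictSupport R s), Nat.card_coe_set_eq]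

/-- The unit sphere of `ℝ³`. -/
abbrev unitSphereR3 : Set (Fin 3 → ℝ) := {p : Fin 3 → ℝ | p 0 ^ 2 + p 1 ^ 2 + p 2 ^ 2 = 1}

theorem evalAddMulThird_injective (k l : ℕ) :
    Function.Injective (evalAddMulThird unitSphereR3 k l) := by
  rw [← LinearMap.ker_eq_bot, LinearMap.ker_eq_bot']
  rintro ⟨⟨p, hp⟩, ⟨q, hq⟩⟩ h
  have key : ∀ x : Fin 2 → ℝ, x 0 ∈ Set.Icc (0 : ℝ) (1 / 2) → x 1 ∈ Set.Icc (0 : ℝ) (1 / 2) →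
      eval x p = 0 ∧ eval x q = 0 := by
    intro x h0 h1
    have hpos : 0 < 1 - x 0 ^ 2 - x 1 ^ 2 := by nlinarith [h0.1, h0.2, h1.1, h1.2]
    have hz := Real.sqrt_pos.2 hpos
    have hsq := Real.sq_sqrt hpos.le
    set z := √(1 - x 0 ^ 2 - x 1 ^ 2)
    have hx : ∀ w : ℝ, (fun i : Fin 2 => (![x 0, x 1, w] : Fin 3 → ℝ) i.castSucc) = x := by
      intro w; ext i; fin_cases i <;> rfl
    have e : ∀ w : ℝ, w ^ 2 = z ^ 2 → eval x p + w * eval x q = 0 := by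
      intro w hw
      have := congrFun h ⟨![x 0, x 1, w], by simp [hw, hsq]⟩
      simpa [evalAddMulThird, hx] using this
    have e1 := e z rfl
    have e2 := e (-z) (by ring)
    refine ⟨by linarith, ?_⟩
    have : z * eval x q = 0 := by linarith
    exact (mul_eq_zero.1 this).resolve_left hz.ne'
  have hinf : ∀ _ : Fin 2, (Set.Icc (0 : ℝ) (1 / 2)).Infinite :=
    fun _ => Set.Icc_infinite (by norm_num)
  have hp0 : p = 0 := funext_set _ hinf fun x hx => by
    simpa using (key x (hx 0 trivial) (hx 1 trivial)).1
  have hq0 : q = 0 := funext_set _ hinf fun x hx => by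
    simpa using (key x (hx 0 trivial) (hx 1 trivial)).2
  subst hp0 hq0
  rfl

theorem mul_pow_third_mem_range (n c : ℕ) (p : MvPolynomial (Fin 2) ℝ)
    (hp : p.totalDegree + c ≤ n) :
    (fun t : unitSphereR3 => eval (fun i : Fin 2 => t.1 i.castSucc) p * t.1 2 ^ c) ∈
      LinearMap.range (evalAddMulThird unitSphereR3 (n + 1) n) := by
  induction c using Nat.twoStepInduction generalizing p with
  | zero =>
    exact ⟨(⟨p, mem_restrictSupport_degree_lt_of_totalDegree_lt (by omega)⟩, 0), by
      ext t; simp [evalAddMulThird]⟩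
  | one =>
    exact ⟨(0, ⟨p, mem_restrictSupport_degree_lt_of_totalDegree_lt (by omega)⟩), by
      ext t; simp [evalAddMulThird, mul_comm]⟩
  | more c ih _ =>
    have hdeg : (p * (1 - X 0 ^ 2 - X 1 ^ 2)).totalDegree ≤ p.totalDegree + 2 := by
      refine (totalDegree_mul _ _).trans (Nat.add_le_add_left ?_ _)
      refine (totalDegree_sub _ _).trans (max_le ((totalDegree_sub _ _).trans ?_) ?_) <;> simp
    convert ih (p * (1 - X 0 ^ 2 - X 1 ^ 2)) (by omega) using 2 with t
    have ht : t.1 0 ^ 2 + t.1 1 ^ 2 + t.1 2 ^ 2 = 1 := t.2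
    have : t.1 2 ^ 2 = 1 - t.1 0 ^ 2 - t.1 1 ^ 2 := by linarith
    simp [pow_add, this]
    ring

theorem range_evalAddMulThird (n : ℕ) :
    (LinearMap.range (evalAddMulThird unitSphereR3 (n + 1) n) : Set (unitSphereR3 → ℝ)) =
      {g | ∃ q : MvPolynomial (Fin 3) ℝ, q.totalDegree ≤ n ∧
        ∀ t : unitSphereR3, g t = eval (t : Fin 3 → ℝ) q} := by
  ext g
  constructor
  · rintro ⟨⟨⟨p, hp⟩, ⟨q, hq⟩⟩, rfl⟩
    refine ⟨rename Fin.castSucc p + X 2 * rename Fin.castSucc q, ?_, fun t => ?_⟩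
    · have hp' := totalDegree_lt_of_mem_restrictSupport n.succ_pos hp
      refine (totalDegree_add _ _).trans (max_le ?_ ?_)
      · exact (totalDegree_rename_le _ _).trans (by omega)
      · rcases n.eq_zero_or_pos with rfl | hn
        · have : q = 0 := by
            rw [← support_eq_empty, Finset.eq_empty_iff_forall_notMem]
            exact fun d hd => Nat.not_lt_zero _ (hq hd)
          simp [this]
        · have hq' := totalDegree_lt_of_mem_restrictSupport hn hq
          refine (totalDegree_mul _ _).trans ?_
          have := totalDegree_rename_le (Fin.castSucc : Fin 2 → Fin 3) q
          rw [totalDegree_X]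
          omega
    · simp [evalAddMulThird, eval_rename, Function.comp_def]
  · rintro ⟨q, hq, hg⟩
    have : g = ∑ d ∈ q.support, fun t : unitSphereR3 =>
        eval (fun i : Fin 2 => t.1 i.castSucc) (C (q.coeff d) * (X 0 ^ d 0 * X 1 ^ d 1)) *
          t.1 2 ^ d 2 := by
      ext t
      rw [hg, eval_eq', Finset.sum_apply]
      refine Finset.sum_congr rfl fun d _ => ?_
      simp [Fin.prod_univ_three]
      ring
    rw [this]
    refine Submodule.sum_mem _ fun d hd => mul_pow_third_mem_range _ _ _ ?_
    have h1 : d 0 + d 1 + d 2 ≤ n := by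
      have := (le_totalDegree hd).trans hq
      rwa [Finsupp.sum_fintype _ _ (by simp), Fin.sum_univ_three] at this
    have h2 : (C (q.coeff d) * (X 0 ^ d 0 * X 1 ^ d 1) : MvPolynomial (Fin 2) ℝ).totalDegree
        ≤ d 0 + d 1 := by
      refine (totalDegree_mul _ _).trans ?_
      rw [totalDegree_C, zero_add]
      refine (totalDegree_mul _ _).trans ?_
      simp
    omega

/-- The space of restrictions to the unit sphere
`S² = {(x,y,z) : x²+y²+z² = 1}` of real trivariate polynomials of total degree at most `n`
has dimension `(n+1)²`. -/
theorem finrank_poly_restricted_to_sphere (n : ℕ) :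
    Module.finrank ℝ (Submodule.span ℝ
      {g : ↥{p : Fin 3 → ℝ | p 0 ^ 2 + p 1 ^ 2 + p 2 ^ 2 = 1} → ℝ |
        ∃ q : MvPolynomial (Fin 3) ℝ, q.totalDegree ≤ n ∧
          ∀ t : ↥{p : Fin 3 → ℝ | p 0 ^ 2 + p 1 ^ 2 + p 2 ^ 2 = 1},
            g t = MvPolynomial.eval (t : Fin 3 → ℝ) q}) = (n + 1) ^ 2 := by
  rw [← range_evalAddMulThird n, Submodule.span_eq,
    LinearMap.finrank_range_of_inj (evalAddMulThird_injective _ _)]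
  have (k : ℕ) : Module.Finite ℝ (restrictSupport ℝ {d : Fin 2 →₀ ℕ | d.degree < k}) :=
    have := (finite_degree_lt (σ := Fin 2) k).to_subtype
    Module.Finite.of_basis (basisRestrictSupport ℝ _)
  rw [Module.finrank_prod, finrank_restrictSupport, finrank_restrictSupport, ncard_degree_lt,
    ncard_degree_lt]
  induction n with
  | zero => simp
  | succ n ih =>
    simp only [Finset.sum_range_succ] at ih ⊢
    linarith
end

section
/- For every f ∈ C(Ω), the hyperinterpolant satisfies the stability estimate ‖L_n f‖_{L²(μ)}² ≤ ⟨f, f⟩_M ≤ μ(Ω) · ‖f‖_∞², and in particular ‖L_n f‖_{L²(μ)} ≤ √(μ(Ω)) · ‖f‖_∞. -/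
open MeasureTheory

/-- The hyperinterpolation operator `L_n f = Σ_j ⟨f, p_j⟩_M p_j`, where
`⟨f, g⟩_M = Σ_i w_i f(x_i) g(x_i)`. -/
noncomputable def hyperinterpolant {d M N : ℕ} (p : Fin N → MvPolynomial (Fin d) ℝ)
    (x : Fin M → (Fin d → ℝ)) (w : Fin M → ℝ) (f : (Fin d → ℝ) → ℝ) :
    (Fin d → ℝ) → ℝ :=
  fun y => ∑ j, (∑ i, w i * f (x i) * MvPolynomial.eval (x i) (p j)) *
    MvPolynomial.eval y (p j)

/-- The uniform norm `‖f‖_∞ = sup_{t ∈ Ω} |f t|` of a function on a set `Ω`. -/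
noncomputable def uniformNormOn {d : ℕ} (Ω : Set (Fin d → ℝ)) (f : (Fin d → ℝ) → ℝ) : ℝ :=
  sSup ((fun t => |f t|) '' Ω)

/-- Bessel's inequality for a weighted discrete inner product. -/
theorem weighted_discrete_bessel {ι κ : Type*} [Fintype ι] [Fintype κ] [DecidableEq κ]
    {w : ι → ℝ} (hw : ∀ i, 0 ≤ w i) {e : κ → ι → ℝ}
    (he : ∀ j k, ∑ i, w i * (e j i * e k i) = if j = k then 1 else 0) (f : ι → ℝ) :
    ∑ i, w i * (∑ j, (∑ l, w l * f l * e j l) * e j i) ^ 2 ≤ ∑ i, w i * f i ^ 2 := by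
  set c : κ → ℝ := fun j => ∑ l, w l * f l * e j l
  have cross : ∑ i, w i * (f i * ∑ j, c j * e j i) = ∑ j, c j ^ 2 := by
    simp only [Finset.mul_sum]
    rw [Finset.sum_comm]
    refine Finset.sum_congr rfl fun j _ => ?_
    rw [sq, show c j * c j = (∑ l, w l * f l * e j l) * c j from rfl, Finset.sum_mul]
    exact Finset.sum_congr rfl fun i _ => by ring
  have square : ∑ i, w i * (∑ j, c j * e j i) ^ 2 = ∑ j, c j ^ 2 := by
    calc ∑ i, w i * (∑ j, c j * e j i) ^ 2
        = ∑ i, ∑ j, ∑ k, c j * c k * (w i * (e j i * e k i)) := by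
          refine Finset.sum_congr rfl fun i _ => ?_
          rw [sq, Finset.sum_mul_sum, Finset.mul_sum]
          refine Finset.sum_congr rfl fun j _ => ?_
          rw [Finset.mul_sum]
          exact Finset.sum_congr rfl fun k _ => by ring
      _ = ∑ j, ∑ k, c j * c k * ∑ i, w i * (e j i * e k i) := by
          rw [Finset.sum_comm]
          refine Finset.sum_congr rfl fun j _ => ?_
          rw [Finset.sum_comm]
          exact Finset.sum_congr rfl fun k _ => (Finset.mul_sum _ _ _).symm
      _ = ∑ j, c j ^ 2 := by simp [he, sq]
  have nonneg : 0 ≤ ∑ i, w i * (f i - ∑ j, c j * e j i) ^ 2 :=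
    Finset.sum_nonneg fun i _ => mul_nonneg (hw i) (sq_nonneg _)
  have expand : ∑ i, w i * (f i - ∑ j, c j * e j i) ^ 2 = ∑ i, w i * f i ^ 2
      - 2 * ∑ i, w i * (f i * ∑ j, c j * e j i) + ∑ i, w i * (∑ j, c j * e j i) ^ 2 := by
    rw [Finset.mul_sum, ← Finset.sum_sub_distrib, ← Finset.sum_add_distrib]
    exact Finset.sum_congr rfl fun i _ => by ring
  linarith

/-- A continuous function on a compact set is bounded there by its uniform norm. -/
theorem abs_le_uniformNormOn {d : ℕ} {Ω : Set (Fin d → ℝ)} (hΩ : IsCompact Ω)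
    {f : (Fin d → ℝ) → ℝ} (hf : ContinuousOn f Ω) {t : Fin d → ℝ} (ht : t ∈ Ω) :
    |f t| ≤ uniformNormOn Ω f :=
  le_csSup (hΩ.image_of_continuousOn hf.abs).bddAbove (Set.mem_image_of_mem _ ht)

/-- Stability of hyperinterpolation:
`‖L_n f‖_{L²(μ)}² ≤ ⟨f, f⟩_M ≤ μ(Ω) ‖f‖_∞²`, and in particular
`‖L_n f‖_{L²(μ)} ≤ √(μ(Ω)) ‖f‖_∞`. -/
theorem hyperinterpolation_stability
    (d n M N : ℕ)
    (Ω : Set (Fin d → ℝ)) (hΩc : IsCompact Ω) (hΩne : Ω.Nonempty)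
    (μ : Measure (Fin d → ℝ)) (hfin : IsFiniteMeasure μ) (hsupp : μ Ωᶜ = 0)
    (p : Fin N → MvPolynomial (Fin d) ℝ)
    (hpdeg : ∀ j, (p j).totalDegree ≤ n)
    (horth : ∀ j k, (∫ t in Ω, MvPolynomial.eval t (p j) * MvPolynomial.eval t (p k) ∂μ) =
      if j = k then 1 else 0)
    (hspan : ∀ q : MvPolynomial (Fin d) ℝ, q.totalDegree ≤ n →
      ∃ a : Fin N → ℝ, ∀ t ∈ Ω,
        MvPolynomial.eval t q = ∑ j, a j * MvPolynomial.eval t (p j))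
    (x : Fin M → (Fin d → ℝ)) (hx : ∀ i, x i ∈ Ω)
    (w : Fin M → ℝ) (hw : ∀ i, 0 < w i)
    (hcub : ∀ q : MvPolynomial (Fin d) ℝ, q.totalDegree ≤ 2 * n →
      ∑ i, w i * MvPolynomial.eval (x i) q = ∫ t in Ω, MvPolynomial.eval t q ∂μ)
    (f : (Fin d → ℝ) → ℝ) (hf : ContinuousOn f Ω) :
    (∫ t in Ω, (hyperinterpolant p x w f t) ^ 2 ∂μ) ≤ ∑ i, w i * (f (x i)) ^ 2 ∧
    ∑ i, w i * (f (x i)) ^ 2 ≤ (μ Ω).toReal * (uniformNormOn Ω f) ^ 2 ∧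
    Real.sqrt (∫ t in Ω, (hyperinterpolant p x w f t) ^ 2 ∂μ) ≤
      Real.sqrt ((μ Ω).toReal) * uniformNormOn Ω f := by
  have gram : ∀ j k, ∑ i, w i * (MvPolynomial.eval (x i) (p j) * MvPolynomial.eval (x i) (p k)) =
      if j = k then 1 else 0 := by
    intro j k
    have hdeg : (p j * p k).totalDegree ≤ 2 * n := by
      have := MvPolynomial.totalDegree_mul (p j) (p k)
      have := hpdeg j
      have := hpdeg k
      omega
    simpa only [map_mul, horth] using hcub _ hdeg
  have exact_sq : ∑ i, w i * (hyperinterpolant p x w f (x i)) ^ 2 =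
      ∫ t in Ω, (hyperinterpolant p x w f t) ^ 2 ∂μ := by
    set q : MvPolynomial (Fin d) ℝ :=
      ∑ j, MvPolynomial.C (∑ i, w i * f (x i) * MvPolynomial.eval (x i) (p j)) * p j with hq
    have heval : ∀ t, hyperinterpolant p x w f t = MvPolynomial.eval t q := by
      intro t
      simp only [hyperinterpolant, hq, map_sum, map_mul, MvPolynomial.eval_C]
    have hqdeg : q.totalDegree ≤ n :=
      MvPolynomial.totalDegree_finsetSum_le fun j _ =>
        (MvPolynomial.totalDegree_mul _ _).trans <| by
          rw [MvPolynomial.totalDegree_C, zero_add]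
          exact hpdeg j
    have hdeg : (q ^ 2).totalDegree ≤ 2 * n :=
      (MvPolynomial.totalDegree_pow q 2).trans (Nat.mul_le_mul_left 2 hqdeg)
    simpa only [heval, map_pow] using hcub _ hdeg
  have weights : ∑ i, w i = (μ Ω).toReal := by
    simpa [Measure.real] using hcub 1 (by simp)
  have lower : (∫ t in Ω, (hyperinterpolant p x w f t) ^ 2 ∂μ) ≤ ∑ i, w i * (f (x i)) ^ 2 := by
    rw [← exact_sq]
    exact weighted_discrete_bessel (fun i => (hw i).le) gram fun i => f (x i)
  have upper : ∑ i, w i * (f (x i)) ^ 2 ≤ (μ Ω).toReal * (uniformNormOn Ω f) ^ 2 := by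
    rw [← weights, Finset.sum_mul]
    refine Finset.sum_le_sum fun i _ => mul_le_mul_of_nonneg_left ?_ (hw i).le
    rw [← sq_abs (f (x i))]
    gcongr
    exact abs_le_uniformNormOn hΩc hf (hx i)
  refine ⟨lower, upper, ?_⟩
  obtain ⟨t, ht⟩ := hΩne
  have norm_nonneg : 0 ≤ uniformNormOn Ω f :=
    (abs_nonneg _).trans (abs_le_uniformNormOn hΩc hf ht)
  calc Real.sqrt (∫ t in Ω, (hyperinterpolant p x w f t) ^ 2 ∂μ)
      ≤ Real.sqrt ((μ Ω).toReal * (uniformNormOn Ω f) ^ 2) := Real.sqrt_le_sqrt (lower.trans upper)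
    _ = Real.sqrt ((μ Ω).toReal) * uniformNormOn Ω f := by
      rw [Real.sqrt_mul ENNReal.toReal_nonneg, Real.sqrt_sq norm_nonneg]
end

section
/- For every polynomial p ∈ P_{⌊n/2⌋}(Ω), the filtered hyperinterpolant reproduces p: F_n p = p as functions on Ω. -/
open MeasureTheory

/-- Filtered hyperinterpolation reproduces polynomials of degree at most
`⌊n/2⌋`: with a triangular `L²(μ)`-orthonormal basis `p_1,…,p_N` of `P_{n−1}(Ω)` whose
degrees are `D j`, a cubature rule with positive weights exact on `P_{n−1+⌊n/2⌋}(Ω)`, and a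
continuous filter `h` with `h ≡ 1` on `[0,1/2]` and `h ≡ 0` on `[1,∞)`, the filtered
hyperinterpolant `F_n f = Σ_j h(deg p_j / n) ⟨f, p_j⟩_M p_j` satisfies `F_n q = q` on `Ω`
for every `q ∈ P_{⌊n/2⌋}(Ω)`. -/
theorem filtered_hyperinterpolation_reproduces
    (d n M N : ℕ) (hn : 1 ≤ n)
    (Ω : Set (Fin d → ℝ)) (hΩc : IsCompact Ω) (hΩne : Ω.Nonempty)
    (μ : Measure (Fin d → ℝ)) (hfin : IsFiniteMeasure μ) (hsupp : μ Ωᶜ = 0)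
    (p : Fin N → MvPolynomial (Fin d) ℝ) (D : Fin N → ℕ)
    (hD : ∀ j, D j ≤ n - 1)
    (hpdeg : ∀ j, (p j).totalDegree ≤ D j)
    (horth : ∀ j k, (∫ t in Ω, MvPolynomial.eval t (p j) * MvPolynomial.eval t (p k) ∂μ) =
      if j = k then 1 else 0)
    (htri : ∀ k ≤ n - 1, ∀ q : MvPolynomial (Fin d) ℝ, q.totalDegree ≤ k →
      ∃ a : Fin N → ℝ, ∀ t ∈ Ω,
        MvPolynomial.eval t q =
          ∑ j ∈ Finset.univ.filter (fun j => D j ≤ k), a j * MvPolynomial.eval t (p j))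
    (x : Fin M → (Fin d → ℝ)) (hx : ∀ i, x i ∈ Ω)
    (w : Fin M → ℝ) (hw : ∀ i, 0 < w i)
    (hcub : ∀ q : MvPolynomial (Fin d) ℝ, q.totalDegree ≤ n - 1 + n / 2 →
      ∑ i, w i * MvPolynomial.eval (x i) q = ∫ t in Ω, MvPolynomial.eval t q ∂μ)
    (h : ℝ → ℝ) (hcont : ContinuousOn h (Set.Ici 0))
    (hone : ∀ t : ℝ, 0 ≤ t → t ≤ 1 / 2 → h t = 1)
    (hzero : ∀ t : ℝ, 1 ≤ t → h t = 0)
    (q : MvPolynomial (Fin d) ℝ) (hq : q.totalDegree ≤ n / 2) :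
    ∀ y ∈ Ω,
      (∑ j, h ((D j : ℝ) / (n : ℝ)) *
          (∑ i, w i * MvPolynomial.eval (x i) q * MvPolynomial.eval (x i) (p j)) *
          MvPolynomial.eval y (p j)) = MvPolynomial.eval y q := by
  intro y hy
  obtain ⟨a, ha⟩ := htri (n / 2) (by omega) q hq
  have discrete_orth : ∀ j k, D k ≤ n / 2 →
      ∑ i, w i * MvPolynomial.eval (x i) (p k) * MvPolynomial.eval (x i) (p j) =
        if j = k then 1 else 0 := by
    intro j k hk
    have hdeg : (p j * p k).totalDegree ≤ n - 1 + n / 2 :=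
      (MvPolynomial.totalDegree_mul _ _).trans
        (add_le_add ((hpdeg j).trans (hD j)) ((hpdeg k).trans hk))
    have hc := hcub _ hdeg
    simp only [map_mul] at hc
    rw [← horth j k, ← hc]
    exact Finset.sum_congr rfl fun i _ => by ring
  have coeff_eq : ∀ j,
      ∑ i, w i * MvPolynomial.eval (x i) q * MvPolynomial.eval (x i) (p j) =
        if D j ≤ n / 2 then a j else 0 := by
    intro j
    calc
      _ = ∑ i, ∑ k ∈ Finset.univ.filter (fun k => D k ≤ n / 2),
            a k * (w i * MvPolynomial.eval (x i) (p k) * MvPolynomial.eval (x i) (p j)) := by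
          refine Finset.sum_congr rfl fun i _ => ?_
          rw [ha _ (hx i), Finset.mul_sum, Finset.sum_mul]
          exact Finset.sum_congr rfl fun k _ => by ring
      _ = ∑ k ∈ Finset.univ.filter (fun k => D k ≤ n / 2), a k * if j = k then 1 else 0 := by
          rw [Finset.sum_comm]
          refine Finset.sum_congr rfl fun k hk => ?_
          rw [← Finset.mul_sum, discrete_orth j k (Finset.mem_filter.mp hk).2]
      _ = if D j ≤ n / 2 then a j else 0 := by
          simp [Finset.sum_ite_eq]
  rw [ha y hy, Finset.sum_filter]
  refine Finset.sum_congr rfl fun j _ => ?_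
  rw [coeff_eq j]
  split_ifs with hj
  · have hn' : (0 : ℝ) < n := by exact_mod_cast hn
    have h2 : (D j : ℝ) * 2 ≤ n := by
      exact_mod_cast (show D j * 2 ≤ n by omega)
    rw [hone _ (by positivity) (by rw [div_le_iff₀ hn']; linarith), one_mul]
  · simp
end
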